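/- For any Λ ∈ ℝ^{m_u×n} for which the stabilizing solution P_u(Λ) of the spoofed ARE exists, the function J̃ is differentiable at Λ and its gradient with respect to the Frobenius inner product satisfies ∇J̃(Λ) = 2(ΓΛ + B_uᵀ P_u(Λ) Π(Λ)). -/

import Mathlib

open Matrix Filter Topology

noncomputable section

/-- A real square matrix is Hurwitz if every complex eigenvalue has strictly
negative real part. -/
def IsHurwitz {N : ℕ} (M : Matrix (Fin N) (Fin N) ℝ) : Prop :=
  ∀ μ : ℂ, μ ∈ spectrum ℂ (M.map (algebraMap ℝ ℂ)) → μ.re < 0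

/-- Frobenius norm of a real matrix. -/
def frobNorm {p q : ℕ} (M : Matrix (Fin p) (Fin q) ℝ) : ℝ :=
  Real.sqrt (Matrix.trace (Mᵀ * M))

/-- Minimal eigenvalue of a (Hermitian) real matrix. -/
def eigMin {m : ℕ} (M : Matrix (Fin m) (Fin m) ℝ) : ℝ :=
  if hM : M.IsHermitian then ⨅ i, hM.eigenvalues i else 0

/-- Maximal eigenvalue of a (Hermitian) real matrix. -/
def eigMax {m : ℕ} (M : Matrix (Fin m) (Fin m) ℝ) : ℝ :=
  if hM : M.IsHermitian then ⨆ i, hM.eigenvalues i else 0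

variable {n m_u m_a : ℕ}

/-- `P` is the stabilizing solution of the spoofed ARE for the gain `Λ`. -/
def IsStabSol (A : Matrix (Fin n) (Fin n) ℝ) (Bu : Matrix (Fin n) (Fin m_u) ℝ)
    (Ba : Matrix (Fin n) (Fin m_a) ℝ) (Q : Matrix (Fin n) (Fin n) ℝ)
    (R : Matrix (Fin m_a) (Fin m_a) ℝ)
    (Λ : Matrix (Fin m_u) (Fin n) ℝ) (P : Matrix (Fin n) (Fin n) ℝ) : Prop :=
  P.PosDef ∧
  (A + Bu * Λ)ᵀ * P + P * (A + Bu * Λ) + Q + P * Ba * R⁻¹ * Baᵀ * P = 0 ∧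
  IsHurwitz (A + Bu * Λ + Ba * R⁻¹ * Baᵀ * P)

/-- `Pim` is a symmetric solution of the Lyapunov equation defining `Π(Λ)`,
given the stabilizing ARE solution `P = P_u(Λ)`. -/
def IsLyapSol (A : Matrix (Fin n) (Fin n) ℝ) (Bu : Matrix (Fin n) (Fin m_u) ℝ)
    (Ba : Matrix (Fin n) (Fin m_a) ℝ) (R : Matrix (Fin m_a) (Fin m_a) ℝ)
    (Kbar : Matrix (Fin m_a) (Fin n) ℝ)
    (Λ : Matrix (Fin m_u) (Fin n) ℝ) (P Pim : Matrix (Fin n) (Fin n) ℝ) : Prop :=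
  Pim.IsHermitian ∧
  (A + Bu * Λ + Ba * R⁻¹ * Baᵀ * P) * Pim + Pim * (A + Bu * Λ + Ba * R⁻¹ * Baᵀ * P)ᵀ
    - Kbarᵀ * R⁻¹ * Baᵀ - Ba * R⁻¹ * Kbar
    + P * Ba * (R⁻¹ * R⁻¹) * Baᵀ + Ba * (R⁻¹ * R⁻¹) * Baᵀ * P = 0

/-- The deception cost `J̃(Λ)`, expressed through a choice function `Pu` for the
stabilizing solution of the spoofed ARE. -/
def Jcost (Ba : Matrix (Fin n) (Fin m_a) ℝ) (R : Matrix (Fin m_a) (Fin m_a) ℝ)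
    (Γ : Matrix (Fin m_u) (Fin m_u) ℝ) (Kbar : Matrix (Fin m_a) (Fin n) ℝ)
    (Pu : Matrix (Fin m_u) (Fin n) ℝ → Matrix (Fin n) (Fin n) ℝ)
    (Λ : Matrix (Fin m_u) (Fin n) ℝ) : ℝ :=
  frobNorm (R⁻¹ * Baᵀ * Pu Λ - Kbar) ^ 2 + Matrix.trace (Λᵀ * Γ * Λ)

/-- The sublevel set `S₀`. -/
def S0 (A : Matrix (Fin n) (Fin n) ℝ) (Bu : Matrix (Fin n) (Fin m_u) ℝ)
    (Ba : Matrix (Fin n) (Fin m_a) ℝ) (Q : Matrix (Fin n) (Fin n) ℝ)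
    (R : Matrix (Fin m_a) (Fin m_a) ℝ) (Γ : Matrix (Fin m_u) (Fin m_u) ℝ)
    (Kbar : Matrix (Fin m_a) (Fin n) ℝ)
    (Pu : Matrix (Fin m_u) (Fin n) ℝ → Matrix (Fin n) (Fin n) ℝ) :
    Set (Matrix (Fin m_u) (Fin n) ℝ) :=
  {Λ | (∃ P, IsStabSol A Bu Ba Q R Λ P) ∧
    Jcost Ba R Γ Kbar Pu Λ ≤ Jcost Ba R Γ Kbar Pu 0}

attribute [local instance] Matrix.normedAddCommGroup Matrix.normedSpace

namespace IsHurwitz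

variable {N K : ℕ}

theorem transpose {M : Matrix (Fin N) (Fin N) ℝ} (hM : IsHurwitz M) : IsHurwitz Mᵀ := by
  intro μ hμ
  apply hM μ
  rw [Matrix.mem_spectrum_iff_isRoot_charpoly] at hμ ⊢
  rwa [Matrix.transpose_map, Matrix.charpoly_transpose] at hμ

/-- The homogeneous Sylvester equation with Hurwitz coefficients has only the zero solution. -/
theorem eq_zero_of_mul_add_mul_eq_zero {M : Matrix (Fin N) (Fin N) ℝ}
    {L : Matrix (Fin K) (Fin K) ℝ} {X : Matrix (Fin N) (Fin K) ℝ}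
    (hM : IsHurwitz M) (hL : IsHurwitz L) (h : M * X + X * L = 0) : X = 0 := by
  set M' : Matrix (Fin N) (Fin N) ℂ := M.map (algebraMap ℝ ℂ)
  set L' : Matrix (Fin K) (Fin K) ℂ := L.map (algebraMap ℝ ℂ)
  set X' : Matrix (Fin N) (Fin K) ℂ := X.map (algebraMap ℝ ℂ) with hX'
  have hcomm : M' * X' = X' * (-L') := by
    rw [Matrix.mul_neg, ← Matrix.map_mul, ← Matrix.map_mul, eq_neg_of_add_eq_zero_left h]
    ext i j
    simp
  have hpow (k : ℕ) : M' ^ k * X' = X' * (-L') ^ k := by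
    induction k with
    | zero => simp
    | succ k ih => rw [pow_succ, Matrix.mul_assoc, hcomm, ← Matrix.mul_assoc, ih,
        Matrix.mul_assoc, ← pow_succ]
  have hpoly (p : Polynomial ℂ) :
      Polynomial.aeval M' p * X' = X' * Polynomial.aeval (-L') p := by
    induction p using Polynomial.induction_on' with
    | add p q hp hq => simp only [map_add, Matrix.add_mul, Matrix.mul_add, hp, hq]
    | monomial k c => simp only [Polynomial.aeval_monomial, Algebra.algebraMap_eq_smul_one,
        Matrix.smul_mul, Matrix.mul_smul, Matrix.one_mul, hpow]
  have hunit : IsUnit (Polynomial.aeval (-L') M'.charpoly) := by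
    by_contra hu
    rcases isEmpty_or_nonempty (Fin K) with hK | hK
    · exact hu (isUnit_of_subsingleton _)
    have hmem := (spectrum.zero_mem_iff ℂ).2 hu
    rw [spectrum.map_polynomial_aeval_of_nonempty _ _
      (spectrum.nonempty_of_isAlgClosed_of_finiteDimensional ℂ _)] at hmem
    obtain ⟨z, hz, hzero⟩ := hmem
    have hzM := hM z ((Matrix.mem_spectrum_iff_isRoot_charpoly).2 hzero)
    rw [← spectrum.neg_eq, Set.mem_neg] at hz
    have hzL := hL (-z) hz
    simp only [Complex.neg_re] at hzL
    linarith
  have hzero : X' * Polynomial.aeval (-L') M'.charpoly = 0 := by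
    rw [← hpoly, Matrix.aeval_self_charpoly, Matrix.zero_mul]
  have hX'0 : X' = 0 := by
    obtain ⟨u, hu⟩ := hunit
    rw [← hu] at hzero
    have := congrArg (· * (↑u⁻¹ : Matrix (Fin K) (Fin K) ℂ)) hzero
    simpa [Matrix.mul_assoc] using this
  ext i j
  have := congrFun (congrFun hX'0 i) j
  simpa [hX'] using this

/-- Being Hurwitz is an open condition. -/
theorem eventually_nhds {M : Matrix (Fin N) (Fin N) ℝ} (hM : IsHurwitz M) :
    ∀ᶠ M' in 𝓝 M, IsHurwitz M' := by
  let r : Matrix (Fin N) (Fin N) ℝ → ℝ := fun M' => ∑ i, ∑ j, |M' i j|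
  have hr : Continuous r := by fun_prop
  have hbound (M' : Matrix (Fin N) (Fin N) ℝ) (μ : ℂ)
      (hμ : μ ∈ spectrum ℂ (M'.map (algebraMap ℝ ℂ))) : ‖μ‖ ≤ r M' := by
    rw [← Matrix.spectrum_toLin', ← Module.End.hasEigenvalue_iff_mem_spectrum] at hμ
    obtain ⟨v, hv⟩ := hμ.exists_hasEigenvector
    have hv0 : 0 < ‖v‖ := norm_pos_iff.2 hv.2
    refine le_of_mul_le_mul_right ?_ hv0
    rw [← norm_smul, ← hv.apply_eq_smul, Matrix.toLin'_apply]
    refine (pi_norm_le_iff_of_nonneg (by positivity)).2 fun i => ?_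
    rw [Matrix.mulVec, dotProduct]
    calc ‖∑ j, M'.map (algebraMap ℝ ℂ) i j * v j‖
        ≤ ∑ j, ‖M'.map (algebraMap ℝ ℂ) i j * v j‖ := norm_sum_le _ _
      _ ≤ ∑ j, |M' i j| * ‖v‖ := by
          refine Finset.sum_le_sum fun j _ => ?_
          rw [norm_mul, Matrix.map_apply, norm_algebraMap', Real.norm_eq_abs]
          gcongr
          exact norm_le_pi_norm v j
      _ ≤ r M' * ‖v‖ := by
          rw [← Finset.sum_mul]
          gcongr
          exact Finset.single_le_sum (f := fun i => ∑ j, |M' i j|)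
            (fun _ _ => by positivity) (Finset.mem_univ i)
  have hK : IsCompact {μ : ℂ | ‖μ‖ ≤ r M + 1 ∧ 0 ≤ μ.re} := by
    have : {μ : ℂ | ‖μ‖ ≤ r M + 1 ∧ 0 ≤ μ.re} =
        Metric.closedBall 0 (r M + 1) ∩ Complex.re ⁻¹' Set.Ici 0 := by
      ext; simp
    rw [this]
    exact (isCompact_closedBall _ _).inter_right (isClosed_Ici.preimage Complex.continuous_re)
  have hdet : ∀ᶠ M' in 𝓝 M, ∀ μ ∈ {μ : ℂ | ‖μ‖ ≤ r M + 1 ∧ 0 ≤ μ.re},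
      (algebraMap ℂ (Matrix (Fin N) (Fin N) ℂ) μ - M'.map (algebraMap ℝ ℂ)).det ≠ 0 := by
    refine hK.eventually_forall_of_forall_eventually fun μ hμ => ?_
    have hcont : Continuous fun p : Matrix (Fin N) (Fin N) ℝ × ℂ =>
        (algebraMap ℂ (Matrix (Fin N) (Fin N) ℂ) p.2 - p.1.map (algebraMap ℝ ℂ)).det := by
      simp only [Algebra.algebraMap_eq_smul_one]
      have h : Continuous fun p : Matrix (Fin N) (Fin N) ℝ × ℂ => p.1.map (algebraMap ℝ ℂ) :=
        continuous_fst.matrix_map Complex.continuous_ofReal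
      fun_prop
    refine hcont.continuousAt.eventually_ne fun h0 => ?_
    refine absurd (hM μ ?_) (not_lt.2 hμ.2)
    rw [spectrum.mem_iff, Matrix.isUnit_iff_isUnit_det]
    simpa using h0
  filter_upwards [hdet, hr.continuousAt.eventually_lt_const (lt_add_one (r M))]
    with M' hM' hrM' μ hμ
  by_contra! hre
  rw [spectrum.mem_iff, Matrix.isUnit_iff_isUnit_det] at hμ
  refine hμ (isUnit_iff_ne_zero.2 (hM' μ ⟨?_, hre⟩))
  refine (hbound M' μ ?_).trans hrM'.le
  rwa [spectrum.mem_iff, Matrix.isUnit_iff_isUnit_det]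

end IsHurwitz

/-- A symmetric matrix close to a positive definite matrix is positive definite. -/
theorem Matrix.PosDef.eventually_nhds {N : ℕ} {P : Matrix (Fin N) (Fin N) ℝ} (hP : P.PosDef) :
    ∀ᶠ P' in 𝓝 P, P'.IsHermitian → P'.PosDef := by
  have h : ∀ᶠ P' in 𝓝 P, ∀ x ∈ Metric.sphere (0 : Fin N → ℝ) 1, 0 < x ⬝ᵥ (P' *ᵥ x) := by
    refine (isCompact_sphere _ _).eventually_forall_of_forall_eventually fun x hx => ?_
    have hcont : Continuous fun p : Matrix (Fin N) (Fin N) ℝ × (Fin N → ℝ) =>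
        p.2 ⬝ᵥ (p.1 *ᵥ p.2) := by
      fun_prop
    refine hcont.continuousAt.eventually_const_lt ?_
    have hx0 : x ≠ 0 := by
      rintro rfl
      simp at hx
    simpa using hP.dotProduct_mulVec_pos hx0
  filter_upwards [h] with P' hP' hsymm
  refine .of_dotProduct_mulVec_pos hsymm fun x hx => ?_
  have hx' : 0 < ‖x‖ := norm_pos_iff.2 hx
  have := hP' (‖x‖⁻¹ • x) (by simp [norm_smul, hx'.ne'])
  rw [Matrix.mulVec_smul, smul_dotProduct, dotProduct_smul, smul_smul] at this
  exact pos_of_mul_pos_right this (by positivity)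

/-- Matrix multiplication as a continuous bilinear map. -/
def matrixMulCLM (p q r : ℕ) :
    Matrix (Fin p) (Fin q) ℝ →L[ℝ] Matrix (Fin q) (Fin r) ℝ →L[ℝ] Matrix (Fin p) (Fin r) ℝ :=
  (LinearMap.mk₂ ℝ (fun M L => M * L) Matrix.add_mul Matrix.smul_mul Matrix.mul_add
    (fun c M L => Matrix.mul_smul M c L)).toContinuousBilinearMap

/-- Left multiplication by a fixed matrix as a continuous linear map. -/
def matrixMulLeftCLM {p q : ℕ} (r : ℕ) (M : Matrix (Fin p) (Fin q) ℝ) :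
    Matrix (Fin q) (Fin r) ℝ →L[ℝ] Matrix (Fin p) (Fin r) ℝ :=
  LinearMap.toContinuousLinearMap (mulLeftLinearMap (Fin r) ℝ M)

/-- Right multiplication by a fixed matrix as a continuous linear map. -/
def matrixMulRightCLM {q r : ℕ} (p : ℕ) (L : Matrix (Fin q) (Fin r) ℝ) :
    Matrix (Fin p) (Fin q) ℝ →L[ℝ] Matrix (Fin p) (Fin r) ℝ :=
  LinearMap.toContinuousLinearMap (mulRightLinearMap (Fin p) ℝ L)

/-- Transposition as a continuous linear map. -/
def matrixTransposeCLM (p q : ℕ) : Matrix (Fin p) (Fin q) ℝ →L[ℝ] Matrix (Fin q) (Fin p) ℝ :=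
  LinearMap.toContinuousLinearMap (Matrix.transposeLinearEquiv (Fin p) (Fin q) ℝ ℝ).toLinearMap

/-- The trace as a continuous linear map. -/
def matrixTraceCLM (p : ℕ) : Matrix (Fin p) (Fin p) ℝ →L[ℝ] ℝ :=
  LinearMap.toContinuousLinearMap (Matrix.traceLinearMap (Fin p) ℝ ℝ)

section Calculus

variable {E : Type*} [NormedAddCommGroup E] [NormedSpace ℝ E] {p q r : ℕ}
  {f : E → Matrix (Fin p) (Fin q) ℝ} {g : E → Matrix (Fin q) (Fin r) ℝ}
  {f' : E →L[ℝ] Matrix (Fin p) (Fin q) ℝ} {g' : E →L[ℝ] Matrix (Fin q) (Fin r) ℝ} {x : E}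

theorem HasStrictFDerivAt.matrix_mul (hf : HasStrictFDerivAt f f' x)
    (hg : HasStrictFDerivAt g g' x) :
    HasStrictFDerivAt (fun y => f y * g y)
      (matrixMulLeftCLM r (f x) ∘L g' + matrixMulRightCLM p (g x) ∘L f') x :=
  ((matrixMulCLM p q r).hasStrictFDerivAt_of_bilinear hf hg).congr_fderiv rfl

theorem HasFDerivAt.matrix_mul (hf : HasFDerivAt f f' x) (hg : HasFDerivAt g g' x) :
    HasFDerivAt (fun y => f y * g y)
      (matrixMulLeftCLM r (f x) ∘L g' + matrixMulRightCLM p (g x) ∘L f') x :=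
  ((matrixMulCLM p q r).hasFDerivAt_of_bilinear hf hg).congr_fderiv rfl

theorem HasStrictFDerivAt.const_matrix_mul (hg : HasStrictFDerivAt g g' x)
    (M : Matrix (Fin p) (Fin q) ℝ) :
    HasStrictFDerivAt (fun y => M * g y) (matrixMulLeftCLM r M ∘L g') x :=
  (matrixMulLeftCLM r M).hasStrictFDerivAt.comp x hg

theorem HasFDerivAt.const_matrix_mul (hg : HasFDerivAt g g' x)
    (M : Matrix (Fin p) (Fin q) ℝ) :
    HasFDerivAt (fun y => M * g y) (matrixMulLeftCLM r M ∘L g') x :=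
  (matrixMulLeftCLM r M).hasFDerivAt.comp x hg

theorem HasStrictFDerivAt.matrix_mul_const (hf : HasStrictFDerivAt f f' x)
    (L : Matrix (Fin q) (Fin r) ℝ) :
    HasStrictFDerivAt (fun y => f y * L) (matrixMulRightCLM p L ∘L f') x :=
  (matrixMulRightCLM p L).hasStrictFDerivAt.comp x hf

theorem HasFDerivAt.matrix_mul_const (hf : HasFDerivAt f f' x)
    (L : Matrix (Fin q) (Fin r) ℝ) :
    HasFDerivAt (fun y => f y * L) (matrixMulRightCLM p L ∘L f') x :=
  (matrixMulRightCLM p L).hasFDerivAt.comp x hf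

theorem HasStrictFDerivAt.matrix_transpose (hf : HasStrictFDerivAt f f' x) :
    HasStrictFDerivAt (fun y => (f y)ᵀ) (matrixTransposeCLM p q ∘L f') x :=
  (matrixTransposeCLM p q).hasStrictFDerivAt.comp x hf

theorem HasFDerivAt.matrix_transpose (hf : HasFDerivAt f f' x) :
    HasFDerivAt (fun y => (f y)ᵀ) (matrixTransposeCLM p q ∘L f') x :=
  (matrixTransposeCLM p q).hasFDerivAt.comp x hf

theorem HasFDerivAt.matrix_trace {f : E → Matrix (Fin p) (Fin p) ℝ}
    {f' : E →L[ℝ] Matrix (Fin p) (Fin p) ℝ} (hf : HasFDerivAt f f' x) :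
    HasFDerivAt (fun y => (f y).trace) (matrixTraceCLM p ∘L f') x :=
  (matrixTraceCLM p).hasFDerivAt.comp x hf

end Calculus

/-- The left-hand side of the spoofed ARE, with quadratic coefficient `S`. -/
def areMap (A : Matrix (Fin n) (Fin n) ℝ) (Bu : Matrix (Fin n) (Fin m_u) ℝ)
    (S Q : Matrix (Fin n) (Fin n) ℝ)
    (v : Matrix (Fin m_u) (Fin n) ℝ × Matrix (Fin n) (Fin n) ℝ) : Matrix (Fin n) (Fin n) ℝ :=
  (A + Bu * v.1)ᵀ * v.2 + v.2 * (A + Bu * v.1) + Q + v.2 * S * v.2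

theorem exists_hasStrictFDerivAt_areMap (A : Matrix (Fin n) (Fin n) ℝ)
    (Bu : Matrix (Fin n) (Fin m_u) ℝ) (S Q : Matrix (Fin n) (Fin n) ℝ)
    (v : Matrix (Fin m_u) (Fin n) ℝ × Matrix (Fin n) (Fin n) ℝ) :
    ∃ F' : Matrix (Fin m_u) (Fin n) ℝ × Matrix (Fin n) (Fin n) ℝ →L[ℝ] Matrix (Fin n) (Fin n) ℝ,
      HasStrictFDerivAt (areMap A Bu S Q) F' v ∧ ∀ H X, F' (H, X) =
      (Bu * H)ᵀ * v.2 + v.2 * (Bu * H) +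
        ((A + Bu * v.1)ᵀ + v.2 * S) * X + X * (A + Bu * v.1 + S * v.2) := by
  have h₂ : HasStrictFDerivAt (fun w : Matrix (Fin m_u) (Fin n) ℝ × Matrix (Fin n) (Fin n) ℝ =>
      w.2) (.snd ℝ _ _) v := hasStrictFDerivAt_snd
  have h₁ : HasStrictFDerivAt (fun w : Matrix (Fin m_u) (Fin n) ℝ × Matrix (Fin n) (Fin n) ℝ =>
      w.1) (.fst ℝ _ _) v := hasStrictFDerivAt_fst
  have h₃ := (h₁.const_matrix_mul Bu).const_add A
  refine ⟨_, (((h₃.matrix_transpose.matrix_mul h₂).add (h₂.matrix_mul h₃)).add_const Q).add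
    ((h₂.matrix_mul_const S).matrix_mul h₂), fun H X => ?_⟩
  change (A + Bu * v.1)ᵀ * X + (Bu * H)ᵀ * v.2 +
    (v.2 * (Bu * H) + X * (A + Bu * v.1)) + (v.2 * S * X + (X * S) * v.2) = _
  simp only [Matrix.mul_add, Matrix.add_mul, Matrix.mul_assoc]
  abel

section Riccati

variable {A : Matrix (Fin n) (Fin n) ℝ} {Bu : Matrix (Fin n) (Fin m_u) ℝ}
  {Ba : Matrix (Fin n) (Fin m_a) ℝ} {Q : Matrix (Fin n) (Fin n) ℝ}
  {R : Matrix (Fin m_a) (Fin m_a) ℝ} {Λ : Matrix (Fin m_u) (Fin n) ℝ}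

/-- Two solutions of a Riccati equation with Hurwitz closed loops are transposes of each other. -/
theorem eq_transpose_of_riccati {M S P₁ P₂ : Matrix (Fin n) (Fin n) ℝ} (hS : Sᵀ = S)
    (h₁ : Mᵀ * P₁ + P₁ * M + Q + P₁ * S * P₁ = 0) (h₂ : Mᵀ * P₂ + P₂ * M + Q + P₂ * S * P₂ = 0)
    (hQ : Qᵀ = Q)
    (hM₁ : IsHurwitz (M + S * P₁)) (hM₂ : IsHurwitz (M + S * P₂)) : P₁ = P₂ᵀ := by
  have h₂' := congrArg Matrix.transpose h₂
  simp only [Matrix.transpose_add, Matrix.transpose_mul, Matrix.transpose_transpose, hS, hQ,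
    Matrix.transpose_zero] at h₂'
  refine sub_eq_zero.1 (hM₂.transpose.eq_zero_of_mul_add_mul_eq_zero hM₁ ?_)
  rw [Matrix.transpose_add, Matrix.transpose_mul, hS]
  rw [← sub_self (0 : Matrix (Fin n) (Fin n) ℝ)]
  nth_rewrite 1 [← h₁]
  rw [← h₂']
  noncomm_ring

theorem transpose_mul_inv_mul_transpose (hR : R.PosDef) :
    (Ba * R⁻¹ * Baᵀ)ᵀ = Ba * R⁻¹ * Baᵀ := by
  have : R⁻¹ᵀ = R⁻¹ := hR.inv.isHermitian
  simp [Matrix.mul_assoc, this]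

theorem IsStabSol.unique (hQ : Q.PosDef) (hR : R.PosDef) {P₁ P₂ : Matrix (Fin n) (Fin n) ℝ}
    (h₁ : IsStabSol A Bu Ba Q R Λ P₁) (h₂ : IsStabSol A Bu Ba Q R Λ P₂) : P₁ = P₂ := by
  have hP₂ : P₂ᵀ = P₂ := h₂.1.isHermitian
  rw [← hP₂]
  refine eq_transpose_of_riccati (transpose_mul_inv_mul_transpose (Ba := Ba) hR) ?_ ?_
    (show Qᵀ = Q from hQ.isHermitian) h₁.2.2 h₂.2.2
  · simpa only [Matrix.mul_assoc] using h₁.2.1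
  · simpa only [Matrix.mul_assoc] using h₂.2.1

/-- Near a gain with a stabilizing solution, the stabilizing solution exists and depends
differentiably on the gain. -/
theorem IsStabSol.exists_differentiableAt (hQ : Q.PosDef) (hR : R.PosDef)
    {P : Matrix (Fin n) (Fin n) ℝ} (hP : IsStabSol A Bu Ba Q R Λ P) :
    ∃ ψ : Matrix (Fin m_u) (Fin n) ℝ → Matrix (Fin n) (Fin n) ℝ,
      (∀ᶠ Λ' in 𝓝 Λ, IsStabSol A Bu Ba Q R Λ' (ψ Λ')) ∧ DifferentiableAt ℝ ψ Λ := by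
  have hS := transpose_mul_inv_mul_transpose (Ba := Ba) hR
  set S := Ba * R⁻¹ * Baᵀ with hSdef
  have hPT : Pᵀ = P := hP.1.isHermitian
  obtain ⟨F', hF, hF'⟩ := exists_hasStrictFDerivAt_areMap A Bu S Q (Λ, P)
  have hinj : Function.Injective (F' ∘L .inr ℝ (Matrix (Fin m_u) (Fin n) ℝ) _) := by
    refine (injective_iff_map_eq_zero _).2 fun X hX => ?_
    refine hP.2.2.transpose.eq_zero_of_mul_add_mul_eq_zero hP.2.2 ?_
    rw [← hSdef, Matrix.transpose_add, Matrix.transpose_mul, hS, hPT]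
    simpa [hF'] using hX
  have hinv : (F' ∘L .inr ℝ (Matrix (Fin m_u) (Fin n) ℝ) _).IsInvertible :=
    ⟨(LinearEquiv.ofInjectiveEndo _ hinj).toContinuousLinearEquiv, by ext; rfl⟩
  have hzero : areMap A Bu S Q (Λ, P) = 0 := by
    simpa only [areMap, S, Matrix.mul_assoc] using hP.2.1
  obtain ⟨ψ, htend, heq, hdiff⟩ : ∃ ψ : Matrix (Fin m_u) (Fin n) ℝ → Matrix (Fin n) (Fin n) ℝ,
      Tendsto ψ (𝓝 Λ) (𝓝 P) ∧
      (∀ᶠ Λ' in 𝓝 Λ, areMap A Bu S Q (Λ', ψ Λ') = areMap A Bu S Q (Λ, P)) ∧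
      DifferentiableAt ℝ ψ Λ :=
    ⟨hF.implicitFunctionOfProdDomain hinv, hF.tendsto_implicitFunctionOfProdDomain hinv,
      hF.eventually_apply_implicitFunctionOfProdDomain hinv,
      (hF.hasStrictFDerivAt_implicitFunctionOfProdDomain hinv).differentiableAt⟩
  refine ⟨ψ, ?_, hdiff⟩
  have hcl : Tendsto (fun Λ' => A + Bu * Λ' + S * ψ Λ') (𝓝 Λ) (𝓝 (A + Bu * Λ + S * P)) := by
    have h₁ : Continuous fun Λ' : Matrix (Fin m_u) (Fin n) ℝ => A + Bu * Λ' := by fun_prop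
    have h₂ : Continuous fun X : Matrix (Fin n) (Fin n) ℝ => S * X := by fun_prop
    exact (h₁.tendsto Λ).add ((h₂.tendsto P).comp htend)
  filter_upwards [heq, htend.eventually hP.1.eventually_nhds, hcl.eventually hP.2.2.eventually_nhds]
    with Λ' hare hpos hhur
  rw [hzero, areMap] at hare
  refine ⟨hpos ?_, by simpa only [S, Matrix.mul_assoc] using hare, hhur⟩
  exact (eq_transpose_of_riccati hS hare hare hQ.isHermitian hhur hhur).symm

end Riccati

theorem frobNorm_sq {p q : ℕ} (M : Matrix (Fin p) (Fin q) ℝ) : frobNorm M ^ 2 = (Mᵀ * M).trace :=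
  Real.sq_sqrt (Matrix.posSemidef_conjTranspose_mul_self M).trace_nonneg

/-- Lemma 2: the gradient of `J̃` with respect to the Frobenius
inner product is `2(ΓΛ + BuᵀP_u(Λ)Π(Λ))`. -/
theorem stmt2
    (A : Matrix (Fin n) (Fin n) ℝ) (Bu : Matrix (Fin n) (Fin m_u) ℝ)
    (Ba : Matrix (Fin n) (Fin m_a) ℝ)
    (Q : Matrix (Fin n) (Fin n) ℝ) (R : Matrix (Fin m_a) (Fin m_a) ℝ)
    (Γ : Matrix (Fin m_u) (Fin m_u) ℝ)
    (hQ : Q.PosDef) (hR : R.PosDef) (hΓ : Γ.PosDef)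
    (Kbar : Matrix (Fin m_a) (Fin n) ℝ)
    (Pu Pim : Matrix (Fin m_u) (Fin n) ℝ → Matrix (Fin n) (Fin n) ℝ)
    (hPu : ∀ Λ, (∃ P, IsStabSol A Bu Ba Q R Λ P) → IsStabSol A Bu Ba Q R Λ (Pu Λ))
    (hPim : ∀ Λ, (∃ P, IsStabSol A Bu Ba Q R Λ P) →
      IsLyapSol A Bu Ba R Kbar Λ (Pu Λ) (Pim Λ))
    (Λ : Matrix (Fin m_u) (Fin n) ℝ) (hΛ : ∃ P, IsStabSol A Bu Ba Q R Λ P) :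
    DifferentiableAt ℝ (Jcost Ba R Γ Kbar Pu) Λ ∧
    ∀ H : Matrix (Fin m_u) (Fin n) ℝ,
      fderiv ℝ (Jcost Ba R Γ Kbar Pu) Λ H =
        Matrix.trace (((2 : ℝ) • (Γ * Λ + Buᵀ * Pu Λ * Pim Λ))ᵀ * H) := by
  obtain ⟨P₀, hP₀⟩ := hΛ
  have hP := hPu Λ ⟨P₀, hP₀⟩
  obtain ⟨ψ, hψ, hψd⟩ := hP.exists_differentiableAt hQ hR
  have hPuψ : Pu =ᶠ[𝓝 Λ] ψ := by
    filter_upwards [hψ] with Λ' hΛ'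
    exact (hPu Λ' ⟨_, hΛ'⟩).unique hQ hR hΛ'
  have hPud : HasFDerivAt Pu (fderiv ℝ Pu Λ) Λ :=
    (hψd.congr_of_eventuallyEq hPuψ).hasFDerivAt
  set P' := fderiv ℝ Pu Λ
  have hS := transpose_mul_inv_mul_transpose (Ba := Ba) hR
  have hRT : R⁻¹ᵀ = R⁻¹ := hR.inv.isHermitian
  have hΓT : Γᵀ = Γ := hΓ.isHermitian
  have hPT : (Pu Λ)ᵀ = Pu Λ := hP.1.isHermitian
  obtain ⟨hPimT, hlyap⟩ := hPim Λ ⟨P₀, hP₀⟩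
  replace hPimT : (Pim Λ)ᵀ = Pim Λ := hPimT
  have hric (H : Matrix (Fin m_u) (Fin n) ℝ) :
      (Bu * H)ᵀ * Pu Λ + Pu Λ * (Bu * H) + (A + Bu * Λ + Ba * R⁻¹ * Baᵀ * Pu Λ)ᵀ * P' H +
        P' H * (A + Bu * Λ + Ba * R⁻¹ * Baᵀ * Pu Λ) = 0 := by
    obtain ⟨F', hF, hF'⟩ := exists_hasStrictFDerivAt_areMap A Bu (Ba * R⁻¹ * Baᵀ) Q (Λ, Pu Λ)
    have hcomp := hF.hasFDerivAt.comp Λ ((hasFDerivAt_id Λ).prodMk hPud)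
    have hzero : (areMap A Bu (Ba * R⁻¹ * Baᵀ) Q ∘ fun Λ' => (id Λ', Pu Λ')) =ᶠ[𝓝 Λ]
        fun _ => 0 := by
      filter_upwards [hψ] with Λ' hΛ'
      simpa only [areMap, Function.comp_apply, id, Matrix.mul_assoc] using (hPu Λ' ⟨_, hΛ'⟩).2.1
    have := congrArg (fun G => G H)
      (hcomp.unique ((hasFDerivAt_const _ Λ).congr_of_eventuallyEq hzero))
    rw [Matrix.transpose_add _ (_ * Pu Λ), Matrix.transpose_mul _ (Pu Λ), hS, hPT]
    exact (hF' H (P' H)).symm.trans this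
  have hsymm (H : Matrix (Fin m_u) (Fin n) ℝ) : (P' H)ᵀ = P' H := by
    refine (sub_eq_zero.1 (hP.2.2.transpose.eq_zero_of_mul_add_mul_eq_zero hP.2.2 ?_)).symm
    have h₁ := hric H
    have h₂ := congrArg Matrix.transpose h₁
    rw [Matrix.transpose_add, Matrix.transpose_add, Matrix.transpose_add,
      Matrix.transpose_mul _ (Pu Λ), Matrix.transpose_mul (Pu Λ), Matrix.transpose_mul _ (P' H),
      Matrix.transpose_mul (P' H), Matrix.transpose_transpose, Matrix.transpose_transpose, hPT,
      Matrix.transpose_zero] at h₂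
    rw [← sub_self (0 : Matrix (Fin n) (Fin n) ℝ)]
    nth_rewrite 1 [← h₁]
    rw [← h₂]
    noncomm_ring
  have hD : HasFDerivAt (fun Λ' => R⁻¹ * Baᵀ * Pu Λ' - Kbar) _ Λ :=
    (hPud.const_matrix_mul (R⁻¹ * Baᵀ)).sub_const Kbar
  have hJ := (hD.matrix_transpose.matrix_mul hD).matrix_trace.add
    (((hasFDerivAt_id Λ).matrix_transpose.matrix_mul_const Γ).matrix_mul
      (hasFDerivAt_id Λ)).matrix_trace
  have hJeq : Jcost Ba R Γ Kbar Pu = fun Λ' =>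
      ((R⁻¹ * Baᵀ * Pu Λ' - Kbar)ᵀ * (R⁻¹ * Baᵀ * Pu Λ' - Kbar)).trace +
        ((id Λ')ᵀ * Γ * id Λ').trace := by
    funext Λ'
    simp only [Jcost, frobNorm_sq, id]
  rw [hJeq]
  refine ⟨hJ.differentiableAt, fun H => ?_⟩
  refine (congrArg (fun G => G H) hJ.fderiv).trans ?_
  set C := R⁻¹ * Baᵀ with hC
  have hCT : Cᵀ = Ba * R⁻¹ := by simp [hC, hRT]
  set D := C * Pu Λ - Kbar with hDdef
  set L := A + Bu * Λ + Ba * R⁻¹ * Baᵀ * Pu Λ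
  have hDC : Dᵀ * C + Cᵀ * D = -(L * Pim Λ + Pim Λ * Lᵀ) := by
    rw [eq_neg_iff_add_eq_zero, ← hlyap, hDdef, Matrix.transpose_sub, Matrix.transpose_mul, hPT,
      hCT, hC]
    simp only [Matrix.sub_mul, Matrix.mul_sub, Matrix.mul_assoc]
    abel
  have htrace : (Dᵀ * (C * P' H)).trace + ((C * P' H)ᵀ * D).trace =
      2 * (Pim Λ * (Pu Λ * (Bu * H))).trace := by
    calc (Dᵀ * (C * P' H)).trace + ((C * P' H)ᵀ * D).trace
        = ((Dᵀ * C + Cᵀ * D) * P' H).trace := by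
          rw [Matrix.transpose_mul, hsymm, Matrix.mul_assoc (P' H), Matrix.trace_mul_comm (P' H),
            Matrix.add_mul, Matrix.trace_add, Matrix.mul_assoc Dᵀ]
      _ = -(Pim Λ * (Lᵀ * P' H + P' H * L)).trace := by
          rw [hDC, Matrix.neg_mul, Matrix.trace_neg, Matrix.add_mul, Matrix.trace_add,
            Matrix.mul_assoc L, Matrix.trace_mul_comm L, Matrix.mul_add (Pim Λ),
            Matrix.trace_add, Matrix.mul_assoc (Pim Λ), Matrix.mul_assoc (Pim Λ), add_comm]
      _ = (Pim Λ * ((Bu * H)ᵀ * Pu Λ)).trace + (Pim Λ * (Pu Λ * (Bu * H))).trace := by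
          have h := hric H
          rw [add_assoc] at h
          rw [eq_neg_of_add_eq_zero_right h, Matrix.mul_neg, Matrix.trace_neg, neg_neg,
            Matrix.mul_add, Matrix.trace_add]
      _ = 2 * (Pim Λ * (Pu Λ * (Bu * H))).trace := by
          rw [← Matrix.trace_transpose (Pim Λ * ((Bu * H)ᵀ * Pu Λ)), Matrix.transpose_mul,
            Matrix.transpose_mul, hPT, hPimT, Matrix.transpose_transpose, Matrix.trace_mul_comm,
            two_mul]
  have hΓtrace : (Hᵀ * (Γ * Λ)).trace = (Λᵀ * (Γ * H)).trace := by
    rw [← Matrix.trace_transpose]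
    simp [hΓT, Matrix.mul_assoc]
  have hlhs : (Dᵀ * (C * P' H)).trace + ((C * P' H)ᵀ * D).trace +
      ((Λᵀ * (Γ * H)).trace + (Hᵀ * (Γ * Λ)).trace) =
        (((2 : ℝ) • (Γ * Λ + Buᵀ * Pu Λ * Pim Λ))ᵀ * H).trace := by
    rw [htrace, hΓtrace]
    simp only [Matrix.transpose_smul, Matrix.transpose_add, Matrix.transpose_mul, hPT, hPimT, hΓT,
      Matrix.transpose_transpose, Matrix.smul_mul, Matrix.trace_smul, Matrix.add_mul,
      Matrix.trace_add, Matrix.mul_assoc, smul_eq_mul]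
    ring
  rw [← hlhs]
  change (Dᵀ * (C * P' H) + (C * P' H)ᵀ * D).trace + (Λᵀ * Γ * H + Hᵀ * Γ * Λ).trace = _
  simp only [Matrix.trace_add, Matrix.mul_assoc]
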